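/- arXiv:2110.11788 — 7 statements merged into one kernel-verified Lean document; each statement's English description precedes it below -/
import Mathlib

section
/- For s > 0, the measurement cost is strictly smaller than the no-measurement cost, i.e. c₁(r) < c₀(r), if and only if all three of the following hold: 2s/(c²·p_D) < r, r < (c²/2 − s)/(c²·(1 − p_D/2)), and s < c²·p_D/4. -/
noncomputable section

/-- The piecewise function `t(r) = r` if `r < 1/2`, else `1 - r`. -/
def tfun (r : ℝ) : ℝ := if r < 1/2 then r else 1 - r

/-- No-measurement cost `c₀(r) = (c²/2)·t(r)`. -/
def costNoMeasure (c r : ℝ) : ℝ := c^2 / 2 * tfun r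

/-- Measurement cost `c₁(r) = (c²/2)·t(r(1−p_D)/(1−r·p_D))·(1−r·p_D) + s`.
(When `r = p_D = 1`, the first summand is `0`, consistent with this formula.) -/
def costMeasure (c pD s r : ℝ) : ℝ :=
  c^2 / 2 * tfun (r * (1 - pD) / (1 - r * pD)) * (1 - r * pD) + s

theorem tfun_eq_min (r : ℝ) : tfun r = min r (1 - r) := by
  unfold tfun
  split_ifs with h
  · rw [min_eq_left (by linarith)]
  · rw [min_eq_right (by linarith)]

theorem tfun_div_mul {x d : ℝ} (hd : 0 < d) : tfun (x / d) * d = min x (d - x) := by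
  rw [tfun_eq_min, min_mul_of_nonneg _ _ hd.le, sub_mul, div_mul_cancel₀ _ hd.ne', one_mul]

theorem costMeasure_eq_min {pD r : ℝ} (c s : ℝ) (hpD1 : pD ≤ 1) (hr0 : 0 ≤ r) (hr1 : r ≤ 1) :
    costMeasure c pD s r = c^2 / 2 * min (r * (1 - pD)) (1 - r) + s := by
  unfold costMeasure
  rw [mul_assoc]
  have hd : 0 ≤ 1 - r * pD := by nlinarith
  rcases hd.eq_or_lt with h | h
  · have hr : r = 1 := by nlinarith
    have hp : pD = 1 := by nlinarith
    simp [hr, hp]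
  · rw [tfun_div_mul h, show 1 - r * pD - r * (1 - pD) = 1 - r by ring]

/-- For `s > 0`, measuring is strictly better than not measuring iff
`2s/(c²p_D) < r`, `r < (c²/2 − s)/(c²(1 − p_D/2))` and `s < c²p_D/4`. -/
theorem optimal_action_iff (c pD s r : ℝ) (hc : 0 < c) (hpD0 : 0 < pD) (hpD1 : pD ≤ 1)
    (hs : 0 < s) (hr0 : 0 ≤ r) (hr1 : r ≤ 1) :
    costMeasure c pD s r < costNoMeasure c r ↔
      (2 * s / (c^2 * pD) < r ∧ r < (c^2 / 2 - s) / (c^2 * (1 - pD / 2)) ∧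
        s < c^2 * pD / 4) := by
  have hK : 0 < c^2 := by positivity
  rw [costMeasure_eq_min c s hpD1 hr0 hr1, costNoMeasure, tfun_eq_min,
    div_lt_iff₀ (by positivity), lt_div_iff₀ (mul_pos hK (by linarith)),
    ← lt_sub_iff_add_lt]
  generalize c^2 = K at *
  constructor
  · intro h
    have hx : K / 2 * min r (1 - r) ≤ K / 2 * r := by gcongr; exact min_le_left _ _
    have hy : K / 2 * min r (1 - r) ≤ K / 2 * (1 - r) := by gcongr; exact min_le_right _ _
    rcases min_choice (r * (1 - pD)) (1 - r) with hm | hm <;> rw [hm] at h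
    · have h1 : 2 * s < r * (K * pD) := by linarith
      have h2 : r * (K * (1 - pD / 2)) < K / 2 - s := by linarith
      refine ⟨h1, h2, ?_⟩
      nlinarith
    · linarith
  · rintro ⟨h1, h2, -⟩
    have hm : K / 2 * min (r * (1 - pD)) (1 - r) ≤ K / 2 * (r * (1 - pD)) := by
      gcongr; exact min_le_left _ _
    rcases min_choice r (1 - r) with h | h <;> rw [h] <;> linarith
end
end

section
/- If s = 0 and p_D > 0, then c₁(r) < c₀(r) holds if and only if 0 < r < 1/(2 − p_D); for r = 0 and for r ≥ 1/(2 − p_D) the two costs are equal. -/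
noncomputable section

/-- Unnormalising the posterior: `t(r(1−p)/(1−rp))·(1−rp)` is `r(1−p)` or `1−r`, according to
whether `r(2−p) < 1`. -/
lemma tfun_posterior_mul {p r : ℝ} (hp0 : 0 ≤ p) (hp1 : p ≤ 1) (hr0 : 0 ≤ r) (hr1 : r ≤ 1) :
    tfun (r * (1 - p) / (1 - r * p)) * (1 - r * p) =
      if r * (2 - p) < 1 then r * (1 - p) else 1 - r := by
  have hD : 0 ≤ 1 - r * p := by nlinarith
  rcases hD.eq_or_lt with h | h
  · have hr : r = 1 := by nlinarith
    subst hr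
    have hp : p = 1 := by linarith
    subst hp
    norm_num
  · have hiff : r * (1 - p) / (1 - r * p) < 1 / 2 ↔ r * (2 - p) < 1 := by
      rw [div_lt_iff₀ h]
      constructor <;> intro _ <;> linarith
    unfold tfun
    simp only [hiff]
    split_ifs
    · exact div_mul_cancel₀ _ h.ne'
    · rw [sub_mul, div_mul_cancel₀ _ h.ne']
      ring

/-- With `s = 0` and `p_D > 0`: `c₁(r) < c₀(r)` iff `0 < r < 1/(2 − p_D)`;
for `r = 0` and for `r ≥ 1/(2 − p_D)` the two costs are equal. -/
theorem zero_cost_strict_iff (c pD r : ℝ) (hc : 0 < c) (hpD0 : 0 < pD) (hpD1 : pD ≤ 1)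
    (hr0 : 0 ≤ r) (hr1 : r ≤ 1) :
    (costMeasure c pD 0 r < costNoMeasure c r ↔ 0 < r ∧ r < 1 / (2 - pD)) ∧
    (r = 0 → costMeasure c pD 0 r = costNoMeasure c r) ∧
    (1 / (2 - pD) ≤ r → costMeasure c pD 0 r = costNoMeasure c r) := by
  have hk : 0 < c ^ 2 / 2 := by positivity
  have hq : 0 < 2 - pD := by linarith
  have hc₁ : costMeasure c pD 0 r =
      c ^ 2 / 2 * if r * (2 - pD) < 1 then r * (1 - pD) else 1 - r := by
    rw [costMeasure, mul_assoc, tfun_posterior_mul hpD0.le hpD1 hr0 hr1, add_zero]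
  rw [hc₁, costNoMeasure, mul_lt_mul_iff_right₀ hk, lt_div_iff₀ hq, div_le_iff₀ hq]
  by_cases h : r * (2 - pD) < 1
  · rw [if_pos h]
    refine ⟨?_, ?_, fun h' => absurd h h'.not_gt⟩
    · unfold tfun
      split_ifs with hr
      · constructor
        · intro hlt
          exact ⟨pos_of_mul_pos_left (by linarith : 0 < r * pD) hpD0.le, h⟩
        · rintro ⟨hr_pos, -⟩
          nlinarith
      · exact ⟨fun _ => ⟨by linarith, h⟩, fun _ => by linarith⟩
    · rintro rfl
      norm_num [tfun]
  · have hr : ¬ r < 1 / 2 := by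
      intro hlt
      nlinarith
    have ht : tfun r = 1 - r := if_neg hr
    rw [if_neg h, ht]
    exact ⟨by simp [h], fun _ => rfl, fun _ => rfl⟩
end
end

section
/- The measurement cost c₁ admits the piecewise-linear form: for r < 1/(2 − p_D), c₁(r) = (c²/2)·r·(1 − p_D) + s, and for 1/(2 − p_D) ≤ r ≤ 1, c₁(r) = (c²/2)·(1 − r) + s. In particular, for r ∈ [0,1] and p_D ∈ (0,1] with r·p_D < 1, one has r·(1 − p_D)/(1 − r·p_D) < 1/2 if and only if r < 1/(2 − p_D), and 1/(2 − p_D) ≥ 1/2. -/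
noncomputable section

/-- The posterior existence probability after a missed detection is below `1/2` exactly when the
prior is below `1 / (2 - pD)`. -/
theorem posterior_lt_half_iff {pD r : ℝ} (hpD1 : pD ≤ 1) (h : r * pD < 1) :
    r * (1 - pD) / (1 - r * pD) < 1/2 ↔ r < 1 / (2 - pD) := by
  rw [div_lt_iff₀ (by linarith), lt_div_iff₀ (by linarith)]
  constructor <;> intro <;> linarith

/-- Piecewise-linear form of the measurement cost `c₁`, together with the
characterisation of the breakpoint. -/
theorem costMeasure_piecewise (c pD s r : ℝ) (hc : 0 < c) (hpD0 : 0 < pD) (hpD1 : pD ≤ 1)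
    (hs : 0 ≤ s) (hr0 : 0 ≤ r) (hr1 : r ≤ 1) :
    (r < 1 / (2 - pD) → costMeasure c pD s r = c^2 / 2 * r * (1 - pD) + s) ∧
    (1 / (2 - pD) ≤ r → costMeasure c pD s r = c^2 / 2 * (1 - r) + s) ∧
    (r * pD < 1 → (r * (1 - pD) / (1 - r * pD) < 1/2 ↔ r < 1 / (2 - pD))) ∧
    1 / (2 - pD) ≥ 1/2 := by
  have hle : r * pD ≤ 1 := mul_le_one₀ hr1 hpD0.le hpD1
  refine ⟨fun h => ?_, fun h => ?_, posterior_lt_half_iff hpD1, ?_⟩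
  · have hlt : r * pD < 1 := by
      rw [lt_div_iff₀ (by linarith)] at h
      nlinarith
    have hne : 1 - r * pD ≠ 0 := by linarith
    rw [costMeasure, tfun, if_pos ((posterior_lt_half_iff hpD1 hlt).2 h)]
    field_simp
  · rcases hle.lt_or_eq with hlt | heq
    · have hne : 1 - r * pD ≠ 0 := by linarith
      rw [costMeasure, tfun, if_neg (mt (posterior_lt_half_iff hpD1 hlt).1 h.not_gt)]
      field_simp
      ring
    · have hr : r = 1 := by nlinarith
      rw [costMeasure, heq, hr]
      ring
  · exact one_div_le_one_div_of_le (by linarith) (by linarith)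
end
end

section
/- (Region 1) For 0 ≤ r < 1/2, the inequality c₁(r) < c₀(r) holds if and only if r > 2s/(c²·p_D). -/
noncomputable section

/-- Region 1: for `0 ≤ r < 1/2`, `c₁(r) < c₀(r)` iff `r > 2s/(c²p_D)`. -/
theorem region1 (c pD s r : ℝ) (hc : 0 < c) (hpD0 : 0 < pD) (hpD1 : pD ≤ 1)
    (hs : 0 ≤ s) (hr0 : 0 ≤ r) (hr : r < 1/2) :
    costMeasure c pD s r < costNoMeasure c r ↔ r > 2 * s / (c^2 * pD) := by
  have hrp : r * pD ≤ r := mul_le_of_le_one_right hr0 hpD1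
  have hrp0 : 0 ≤ r * pD := by positivity
  have hden : 0 < 1 - r * pD := by linarith
  have hpost : r * (1 - pD) / (1 - r * pD) < 1 / 2 := by
    rw [div_lt_iff₀ hden]
    linarith
  have hcost : costMeasure c pD s r = c^2 / 2 * (r * (1 - pD)) + s := by
    rw [costMeasure, tfun, if_pos hpost, mul_assoc, div_mul_cancel₀ _ hden.ne']
  rw [hcost, costNoMeasure, tfun, if_pos hr, gt_iff_lt, div_lt_iff₀ (by positivity)]
  constructor <;> intro h <;> linarith
end
end

section
/- (Region 2) For 1/2 ≤ r < 1/(2 − p_D), the inequality c₁(r) < c₀(r) holds if and only if r < (c²/2 − s)/(c²·(1 − p_D/2)). -/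
noncomputable section

/-- Region 2: for `1/2 ≤ r < 1/(2 − p_D)`, `c₁(r) < c₀(r)` iff
`r < (c²/2 − s)/(c²(1 − p_D/2))`. -/
theorem region2 (c pD s r : ℝ) (hc : 0 < c) (hpD0 : 0 < pD) (hpD1 : pD ≤ 1)
    (hs : 0 ≤ s) (hr0 : 1/2 ≤ r) (hr : r < 1 / (2 - pD)) :
    costMeasure c pD s r < costNoMeasure c r ↔
      r < (c^2 / 2 - s) / (c^2 * (1 - pD / 2)) := by
  have hr' : r * (2 - pD) < 1 := (lt_div_iff₀ (by linarith)).mp hr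
  have hD : 0 < 1 - r * pD := by nlinarith
  have ht : r * (1 - pD) / (1 - r * pD) < 1 / 2 := by
    rw [div_lt_iff₀ hD]
    linarith
  rw [costMeasure, costNoMeasure, tfun, tfun, if_pos ht, if_neg hr0.not_gt, mul_assoc,
    div_mul_cancel₀ _ hD.ne', lt_div_iff₀ (mul_pos (pow_pos hc 2) (by linarith))]
  constructor <;> intro h <;> linarith
end
end

section
/- (Region 3) For 1/(2 − p_D) ≤ r ≤ 1, one has c₁(r) = c₀(r) + s; hence for s > 0 it is never optimal to measure in this region, and for s = 0 both actions have equal cost. -/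
noncomputable section

theorem tfun_of_half_le {r : ℝ} (h : 1 / 2 ≤ r) : tfun r = 1 - r :=
  if_neg h.not_gt

theorem tfun_posterior_mul_s7 {pD r : ℝ} (hpD1 : pD ≤ 1)
    (hr0 : 1 / (2 - pD) ≤ r) (hr1 : r ≤ 1) :
    tfun (r * (1 - pD) / (1 - r * pD)) * (1 - r * pD) = 1 - r := by
  have hr : 1 ≤ r * (2 - pD) := (div_le_iff₀ (by linarith)).1 hr0
  have hnonneg : 0 ≤ 1 - r * pD := by nlinarith
  rcases hnonneg.eq_or_lt with h | h
  · have : r = 1 := by nlinarith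
    rw [← h, mul_zero, this, sub_self]
  · rw [tfun_of_half_le ((le_div_iff₀ h).2 (by linarith))]
    field_simp
    ring

/-- Region 3: for `1/(2 − p_D) ≤ r ≤ 1`, `c₁(r) = c₀(r) + s`; hence for
`s > 0` measuring is strictly worse, and for `s = 0` both costs coincide. -/
theorem region3 (c pD s r : ℝ) (hc : 0 < c) (hpD0 : 0 < pD) (hpD1 : pD ≤ 1)
    (hs : 0 ≤ s) (hr0 : 1 / (2 - pD) ≤ r) (hr1 : r ≤ 1) :
    costMeasure c pD s r = costNoMeasure c r + s ∧
    (0 < s → costNoMeasure c r < costMeasure c pD s r) ∧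
    (s = 0 → costMeasure c pD s r = costNoMeasure c r) := by
  have half_le : 1 / 2 ≤ r :=
    (one_div_le_one_div_of_le (by linarith) (by linarith)).trans hr0
  have cost_eq : costMeasure c pD s r = costNoMeasure c r + s := by
    rw [costMeasure, costNoMeasure, mul_assoc,
      tfun_posterior_mul_s7 hpD1 hr0 hr1, tfun_of_half_le half_le]
  exact ⟨cost_eq, fun h => by linarith, fun h => by linarith⟩
end
end

section
/- If p_D = 1, then c₁(r) = s for every r ∈ [0,1] (the measurement cost is constant since there is no estimation error), and for s > 0 one has c₁(r) < c₀(r) if and only if t(r) > 2s/c²; in particular, even with perfect detection it is optimal not to measure when r is sufficiently close to 0 or to 1. -/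
noncomputable section

theorem costMeasure_one (c s r : ℝ) : costMeasure c 1 s r = s := by
  simp [costMeasure, tfun]

theorem costMeasure_one_lt_iff {c : ℝ} (hc : 0 < c) (s r : ℝ) :
    costMeasure c 1 s r < costNoMeasure c r ↔ tfun r > 2 * s / c^2 := by
  rw [costMeasure_one, costNoMeasure, gt_iff_lt, div_lt_iff₀ (by positivity)]
  constructor <;> intro h <;> linarith

/-- Perfect detection: if `p_D = 1` then `c₁(r) = s` for all `r ∈ [0,1]`, and for
`s > 0`, `c₁(r) < c₀(r)` iff `t(r) > 2s/c²`; in particular it is optimal not to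
measure when `r` is sufficiently close to `0` or to `1`. -/
theorem perfect_detection (c pD s : ℝ) (hc : 0 < c) (hpD0 : 0 < pD) (hpD1 : pD ≤ 1)
    (hs : 0 ≤ s) (hpD : pD = 1) :
    (∀ r : ℝ, 0 ≤ r → r ≤ 1 → costMeasure c pD s r = s) ∧
    (0 < s → ∀ r : ℝ, 0 ≤ r → r ≤ 1 →
      (costMeasure c pD s r < costNoMeasure c r ↔ tfun r > 2 * s / c^2)) ∧
    (0 < s → ∃ ε > (0:ℝ), ∀ r : ℝ, 0 ≤ r → r ≤ 1 → (r < ε ∨ 1 - ε < r) →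
      ¬ costMeasure c pD s r < costNoMeasure c r) := by
  subst hpD
  refine ⟨fun r _ _ => costMeasure_one c s r, fun _ r _ _ => costMeasure_one_lt_iff hc s r,
    fun hs => ⟨2 * s / c^2, by positivity, fun r _ _ hr => ?_⟩⟩
  rw [costMeasure_one_lt_iff hc, tfun_eq_min, gt_iff_lt, lt_min_iff]
  rintro ⟨h₁, h₂⟩
  rcases hr with hr | hr <;> linarith
end
end
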